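/- arXiv:0710.1606 — 4 statements merged into one kernel-verified Lean document; each statement's English description precedes it below -/
import Mathlib

section
/- Let S be a nonempty finite type and let L : ℝ → Matrix S S ℝ be a continuous one-parameter family of matrices such that L(t) is a Markov generator for every t. Then for every t₁ ∈ ℝ there exists a unique differentiable function U : ℝ → Matrix S S ℝ with U(t₁) = 1 (the identity matrix) and U'(t) = U(t) * L(t) for all t; moreover, U(t) is row-stochastic for every t ≥ t₁. -/
open scoped BigOperators

section BanachAlgebra

variable {A : Type*} [NormedRing A] [NormedAlgebra ℝ A]

/-- The `n`-th term of the Dyson series based at `a` for the linear equation `U' = U * L`. -/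
noncomputable def dysonTerm (L : ℝ → A) (a : ℝ) : ℕ → ℝ → A
  | 0 => fun _ => 1
  | n + 1 => fun t => ∫ s in a..t, dysonTerm L a n s * L s

lemma dysonTerm_succ_self (L : ℝ → A) (a : ℝ) (n : ℕ) : dysonTerm L a (n + 1) a = 0 := by
  simp [dysonTerm]

lemma tsum_dysonTerm_self (L : ℝ → A) (a : ℝ) : ∑' n, dysonTerm L a n a = 1 := by
  rw [tsum_eq_single 0]
  · rfl
  · rintro (_ | n) h
    · exact absurd rfl h
    · exact dysonTerm_succ_self L a n

/-- Two global solutions of the linear equation `U' = U * L` which agree at one time are equal. -/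
lemma eq_of_hasDerivAt_mul {L : ℝ → A} (hL : Continuous L) {a : ℝ} {U V : ℝ → A}
    (hU : ∀ t, HasDerivAt U (U t * L t) t) (hV : ∀ t, HasDerivAt V (V t * L t) t)
    (h : U a = V a) : U = V := by
  ext t
  obtain ⟨M, hM⟩ := (isCompact_Icc (a := min a t - 1)
    (b := max a t + 1)).exists_bound_of_continuousOn hL.continuousOn
  have hlip : ∀ s ∈ Set.Ioo (min a t - 1) (max a t + 1),
      LipschitzOnWith M.toNNReal (fun x : A => x * L s) Set.univ := by
    intro s hs
    refine (LipschitzWith.of_dist_le_mul fun x y => ?_).lipschitzOnWith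
    rw [dist_eq_norm, dist_eq_norm, ← sub_mul, mul_comm]
    exact (norm_mul_le _ _).trans (by
      gcongr
      exact (hM s (Set.Ioo_subset_Icc_self hs)).trans (Real.le_coe_toNNReal M))
  exact ODE_solution_unique_of_mem_Ioo (v := fun s x => x * L s) hlip
    (t₀ := a) (by grind) (fun s _ => ⟨hU s, Set.mem_univ _⟩) (fun s _ => ⟨hV s, Set.mem_univ _⟩)
    h (by grind)

lemma continuous_dysonTerm {L : ℝ → A} (hL : Continuous L) (a : ℝ) (n : ℕ) :
    Continuous (dysonTerm L a n) := by
  induction n with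
  | zero => exact continuous_const
  | succ n ih =>
    exact intervalIntegral.continuous_primitive
      (fun _ _ => (ih.mul hL).intervalIntegrable _ _) _

lemma norm_dysonTerm_le {L : ℝ → A} {a M t : ℝ} (hM : ∀ s ∈ Set.uIcc a t, ‖L s‖ ≤ M) (n : ℕ) :
    ‖dysonTerm L a n t‖ ≤ ‖(1 : A)‖ * ((M * |t - a|) ^ n / n.factorial) := by
  have hM0 : 0 ≤ M := (norm_nonneg _).trans (hM a Set.left_mem_uIcc)
  induction n generalizing t with
  | zero => simp [dysonTerm]
  | succ n ih =>
    calc ‖dysonTerm L a (n + 1) t‖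
        ≤ ∫ s in Set.uIoc a t, ‖(1 : A)‖ * (M ^ (n + 1) / n.factorial) * |s - a| ^ n := by
          simp only [dysonTerm]
          rw [intervalIntegral.norm_intervalIntegral_eq]
          refine MeasureTheory.norm_integral_le_of_norm_le
            (Continuous.integrableOn_uIoc (by fun_prop)) ?_
          filter_upwards [MeasureTheory.ae_restrict_mem measurableSet_uIoc] with s hs
          have hs' : s ∈ Set.uIcc a t := Set.uIoc_subset_uIcc hs
          calc ‖dysonTerm L a n s * L s‖ ≤ ‖dysonTerm L a n s‖ * ‖L s‖ := norm_mul_le _ _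
            _ ≤ ‖(1 : A)‖ * ((M * |s - a|) ^ n / n.factorial) * M := by
              gcongr
              · exact ih fun r hr => hM r (Set.uIcc_subset_uIcc_left hs' hr)
              · exact hM s hs'
            _ = _ := by ring
      _ = ‖(1 : A)‖ * ((M * |t - a|) ^ (n + 1) / (n + 1).factorial) := by
          rw [MeasureTheory.integral_const_mul, integral_pow_abs_sub_uIoc, Nat.factorial_succ,
            mul_pow]
          push_cast
          field_simp

variable [CompleteSpace A]

lemma hasDerivAt_dysonTerm_succ {L : ℝ → A} (hL : Continuous L) (a : ℝ) (n : ℕ) (t : ℝ) :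
    HasDerivAt (dysonTerm L a (n + 1)) (dysonTerm L a n t * L t) t :=
  ((continuous_dysonTerm hL a n).mul hL).integral_hasStrictDerivAt a t |>.hasDerivAt

lemma summable_dysonTerm {L : ℝ → A} (hL : Continuous L) (a t : ℝ) :
    Summable fun n => dysonTerm L a n t := by
  obtain ⟨M, hM⟩ := (isCompact_uIcc (a := a) (b := t)).exists_bound_of_continuousOn
    hL.continuousOn
  exact .of_norm_bounded ((Real.summable_pow_div_factorial _).mul_left _)
    fun n => norm_dysonTerm_le hM n

/-- The sum of the Dyson series is a global solution of `U' = U * L`. -/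
lemma hasDerivAt_tsum_dysonTerm {L : ℝ → A} (hL : Continuous L) (a t : ℝ) :
    HasDerivAt (fun s => ∑' n, dysonTerm L a n s) ((∑' n, dysonTerm L a n t) * L t) t := by
  set R := |t - a| + 1
  have hR : 0 < R := by positivity
  obtain ⟨M, hM⟩ := (isCompact_closedBall a R).exists_bound_of_continuousOn hL.continuousOn
  have hM0 : 0 ≤ M := (norm_nonneg _).trans (hM a (Metric.mem_closedBall_self hR.le))
  have hball : t ∈ Metric.ball a R := by simp [R, Real.dist_eq]
  have hder : HasDerivAt (fun s => ∑' n, dysonTerm L a (n + 1) s)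
      (∑' n, dysonTerm L a n t * L t) t := by
    have hbound : ∀ n, ∀ s ∈ Metric.ball a R, ‖dysonTerm L a n s * L s‖ ≤
        ‖(1 : A)‖ * ((M * R) ^ n / n.factorial) * M := by
      intro n s hs
      have hs' : |s - a| ≤ R := by simpa [Real.dist_eq] using (Metric.mem_ball.1 hs).le
      have hsub : ∀ r ∈ Set.uIcc a s, ‖L r‖ ≤ M := fun r hr => hM r <| by
        rw [Metric.mem_closedBall, Real.dist_eq]
        exact (Set.abs_sub_left_of_mem_uIcc hr).trans hs'
      refine (norm_mul_le _ _).trans ?_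
      gcongr
      · exact (norm_dysonTerm_le hsub n).trans (by gcongr)
      · exact hsub s Set.right_mem_uIcc
    have hsum : Summable fun n : ℕ => ‖(1 : A)‖ * ((M * R) ^ n / n.factorial) * M :=
      ((Real.summable_pow_div_factorial _).mul_left _).mul_right _
    have hsum_self : Summable fun n => dysonTerm L a (n + 1) a := by
      simpa only [dysonTerm_succ_self] using summable_zero
    exact hasDerivAt_tsum_of_isPreconnected hsum Metric.isOpen_ball
      (convex_ball a R).isPreconnected (fun n s _ => hasDerivAt_dysonTerm_succ hL a n s)
      hbound (Metric.mem_ball_self hR) hsum_self hball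
  rw [(summable_dysonTerm hL a t).tsum_mul_right] at hder
  refine (hder.const_add (1 : A)).congr_of_eventuallyEq (.of_forall fun s => ?_)
  exact (summable_dysonTerm hL a s).tsum_eq_zero_add

end BanachAlgebra

attribute [local instance] Matrix.linftyOpNormedRing Matrix.linftyOpNormedAlgebra

section Matrix

variable {S : Type*} [Fintype S]

lemma sum_apply_eq_of_hasDerivAt_mul {L U : ℝ → Matrix S S ℝ}
    (hrow : ∀ t x, ∑ y, L t x y = 0)
    (hU : ∀ t x y, HasDerivAt (fun s => U s x y) ((U t * L t) x y) t) (t a : ℝ) (x : S) :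
    ∑ y, U t x y = ∑ y, U a x y := by
  have hd : ∀ s, HasDerivAt (fun s => ∑ y, U s x y) 0 s := fun s => by
    refine (HasDerivAt.fun_sum fun y _ => hU s x y).congr_deriv ?_
    simp only [Matrix.mul_apply]
    rw [Finset.sum_comm]
    simp [← Finset.mul_sum, hrow]
  exact is_const_of_deriv_eq_zero (fun s => (hd s).differentiableAt) (fun s => (hd s).deriv) t a

variable [DecidableEq S]

lemma Matrix.hasDerivAt_iff {U : ℝ → Matrix S S ℝ} {U' : Matrix S S ℝ} {t : ℝ} :
    HasDerivAt U U' t ↔ ∀ x y, HasDerivAt (fun s => U s x y) (U' x y) t := by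
  constructor
  · intro h x y
    exact ((Matrix.entryLinearMap ℝ ℝ x y).toContinuousLinearMap.hasFDerivAt.comp_hasDerivAt t h :)
  · intro h
    have hsum : HasDerivAt (fun s => ∑ x, ∑ y, U s x y • Matrix.single x y (1 : ℝ))
        (∑ x, ∑ y, U' x y • Matrix.single x y (1 : ℝ)) t :=
      .fun_sum fun x _ => .fun_sum fun y _ => (h x y).smul_const _
    have hrep : ∀ B : Matrix S S ℝ, ∑ x, ∑ y, B x y • Matrix.single x y (1 : ℝ) = B := fun B => by
      simpa using (Matrix.matrix_eq_sum_single B).symm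
    simpa only [hrep] using hsum

/-- If `L` has nonnegative entries, so do all terms of its Dyson series at later times. -/
lemma dysonTerm_apply_nonneg {L : ℝ → Matrix S S ℝ} (hL : Continuous L)
    (hnn : ∀ t x y, 0 ≤ L t x y) (a : ℝ) (n : ℕ) {t : ℝ} (ht : a ≤ t) (x y : S) :
    0 ≤ dysonTerm L a n t x y := by
  induction n generalizing t x y with
  | zero =>
    simp only [dysonTerm, Matrix.one_apply]
    split_ifs <;> norm_num
  | succ n ih =>
    have hd : ∀ s, HasDerivAt (fun s => dysonTerm L a (n + 1) s x y)
        ((dysonTerm L a n s * L s) x y) s :=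
      fun s => Matrix.hasDerivAt_iff.1 (hasDerivAt_dysonTerm_succ hL a n s) x y
    have hmono : MonotoneOn (fun s => dysonTerm L a (n + 1) s x y) (Set.Ici a) := by
      refine monotoneOn_of_deriv_nonneg (convex_Ici a)
        (fun s _ => (hd s).continuousAt.continuousWithinAt)
        (fun s _ => (hd s).differentiableAt.differentiableWithinAt) fun s hs => ?_
      rw [interior_Ici] at hs
      rw [(hd s).deriv, Matrix.mul_apply]
      exact Finset.sum_nonneg fun z _ => mul_nonneg (ih hs.le x z) (hnn s z y)
    simpa [dysonTerm_succ_self] using hmono (Set.mem_Ici.2 le_rfl) ht ht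

lemma apply_nonneg_of_hasDerivAt_mul_of_nonneg {L U : ℝ → Matrix S S ℝ} (hL : Continuous L)
    (hnn : ∀ t x y, 0 ≤ L t x y) {a : ℝ} (hU : ∀ t, HasDerivAt U (U t * L t) t) (hUa : U a = 1)
    {t : ℝ} (ht : a ≤ t) (x y : S) : 0 ≤ U t x y := by
  have hUD : U = fun s => ∑' n, dysonTerm L a n s :=
    eq_of_hasDerivAt_mul hL hU (hasDerivAt_tsum_dysonTerm hL a)
      (hUa.trans (tsum_dysonTerm_self L a).symm)
  have hsum : HasSum (fun n => dysonTerm L a n t x y) (U t x y) := by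
    rw [hUD]
    exact (summable_dysonTerm hL a t).hasSum.map (Matrix.entryLinearMap ℝ ℝ x y)
      (Matrix.entryLinearMap ℝ ℝ x y).continuous_of_finiteDimensional
  exact hsum.nonneg fun n => dysonTerm_apply_nonneg hL hnn a n ht x y

/-- If `L` has nonnegative off-diagonal entries, the propagator has nonnegative entries. -/
lemma apply_nonneg_of_hasDerivAt_mul {L U : ℝ → Matrix S S ℝ} (hL : Continuous L)
    (hoff : ∀ t x y, x ≠ y → 0 ≤ L t x y) {a : ℝ} (hU : ∀ t, HasDerivAt U (U t * L t) t)
    (hUa : U a = 1) {t : ℝ} (ht : a ≤ t) (x y : S) : 0 ≤ U t x y := by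
  set c : ℝ → ℝ := fun s => ∑ z, |L s z z|
  have hc : Continuous c := by fun_prop
  set φ : ℝ → ℝ := fun s => Real.exp (∫ r in a..s, c r)
  have hφ : ∀ s, HasDerivAt φ (φ s * c s) s := fun s =>
    (hc.integral_hasStrictDerivAt a s).hasDerivAt.exp
  have hV : ∀ s, HasDerivAt (fun s => φ s • U s)
      ((φ s • U s) * (L s + c s • (1 : Matrix S S ℝ))) s := fun s => by
    refine ((hφ s).fun_smul (hU s)).congr_deriv ?_
    simp [mul_add, smul_smul, mul_comm]
  have hnn : ∀ s z w, 0 ≤ (L s + c s • (1 : Matrix S S ℝ)) z w := by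
    intro s z w
    rcases eq_or_ne z w with rfl | hzw
    · have : |L s z z| ≤ c s :=
        Finset.single_le_sum (f := fun z => |L s z z|) (fun _ _ => abs_nonneg _)
          (Finset.mem_univ z)
      simp only [Matrix.add_apply, Matrix.smul_apply, Matrix.one_apply_eq, smul_eq_mul, mul_one]
      linarith [neg_abs_le (L s z z)]
    · simpa [Matrix.one_apply_ne hzw] using hoff s z w hzw
  have h := apply_nonneg_of_hasDerivAt_mul_of_nonneg
    (hL.add (hc.smul continuous_const)) hnn hV (by simp [φ, hUa]) ht x y
  exact nonneg_of_mul_nonneg_right h (Real.exp_pos _)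

end Matrix

/-- **Existence, uniqueness and row-stochasticity of the propagator.**
For a continuous family `L : ℝ → Matrix S S ℝ` of Markov generators, for every
`t₁` there is a unique (entrywise) differentiable `U : ℝ → Matrix S S ℝ` with
`U t₁ = 1` and `U' t = U t * L t`; moreover this `U t` is row-stochastic for
every `t ≥ t₁`. -/
theorem propagator_existsUnique_and_rowStochastic
    {S : Type*} [Fintype S] [Nonempty S] [DecidableEq S]
    (L : ℝ → Matrix S S ℝ)
    (hcont : ∀ x y : S, Continuous fun t => L t x y)
    (hoff : ∀ t : ℝ, ∀ x y : S, x ≠ y → 0 ≤ L t x y)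
    (hrow : ∀ t : ℝ, ∀ x : S, ∑ y : S, L t x y = 0)
    (t₁ : ℝ) :
    (∃! U : ℝ → Matrix S S ℝ,
        U t₁ = 1 ∧
          ∀ (t : ℝ) (x y : S), HasDerivAt (fun s => U s x y) ((U t * L t) x y) t) ∧
      (∀ U : ℝ → Matrix S S ℝ,
        (U t₁ = 1 ∧
            ∀ (t : ℝ) (x y : S), HasDerivAt (fun s => U s x y) ((U t * L t) x y) t) →
        ∀ t : ℝ, t₁ ≤ t →
          (∀ x y : S, 0 ≤ U t x y) ∧ (∀ x : S, ∑ y : S, U t x y = 1)) := by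
  have hL : Continuous L := continuous_matrix hcont
  simp only [← Matrix.hasDerivAt_iff]
  refine ⟨⟨fun t => ∑' n, dysonTerm L t₁ n t,
    ⟨tsum_dysonTerm_self L t₁, hasDerivAt_tsum_dysonTerm hL t₁⟩, fun V hV =>
      eq_of_hasDerivAt_mul hL hV.2 (hasDerivAt_tsum_dysonTerm hL t₁)
        (hV.1.trans (tsum_dysonTerm_self L t₁).symm)⟩, fun U hU t ht =>
    ⟨apply_nonneg_of_hasDerivAt_mul hL hoff hU.2 hU.1 ht, fun x => ?_⟩⟩
  rw [sum_apply_eq_of_hasDerivAt_mul hrow (fun t => Matrix.hasDerivAt_iff.1 (hU.2 t)) t t₁, hU.1]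
  simp [Matrix.one_apply]
end

section
/- (Finite-state core of the Fundamental Theorem of Finance / Stiemke alternative.) Let D be a nonempty finite type, n a natural number, and ξ : Fin n → (D → ℝ) a finite family of vectors. Assume that for every v : Fin n → ℝ the vector w = ∑_k v k • ξ k satisfies: either w = 0, or there exist y₊, y₋ ∈ D with w y₊ > 0 and w y₋ < 0 (no arbitrage condition). Then there exists g : D → ℝ with g y > 0 for every y ∈ D and ∑_{y ∈ D} ξ k y * g y = 0 for every k : Fin n. -/
open scoped BigOperators

/-- A linear functional bounded below on a submodule vanishes on it. -/
theorem Submodule.apply_eq_zero_of_forall_lt {E : Type*} [AddCommGroup E] [Module ℝ E]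
    (W : Submodule ℝ E) (f : E →ₗ[ℝ] ℝ) {c : ℝ} (h : ∀ w ∈ W, c < f w) {w : E} (hw : w ∈ W) :
    f w = 0 := by
  by_contra hne
  have := h _ (W.smul_mem (c / f w) hw)
  rw [map_smul, smul_eq_mul, div_mul_cancel₀ _ hne] at this
  exact lt_irrefl _ this

/-- A subspace of `D → ℝ` disjoint from the standard simplex is orthogonal to a strictly positive
vector. -/
theorem Submodule.exists_pos_orthogonal_of_disjoint_stdSimplex {D : Type*} [Fintype D]
    (W : Submodule ℝ (D → ℝ)) (hW : Disjoint (stdSimplex ℝ D) (W : Set (D → ℝ))) :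
    ∃ g : D → ℝ, (∀ y, 0 < g y) ∧ ∀ w ∈ W, ∑ y, w y * g y = 0 := by
  classical
  obtain ⟨f, u, v, hfu, huv, hfv⟩ := geometric_hahn_banach_compact_closed
    (convex_stdSimplex ℝ D) (isCompact_stdSimplex ℝ D) W.convex W.closed_of_finiteDimensional hW
  have hv : v < 0 := by simpa using hfv 0 W.zero_mem
  refine ⟨fun y => -f (Pi.single y 1), fun y => ?_, fun w hw => ?_⟩
  · have := hfu _ (single_mem_stdSimplex ℝ y)
    linarith
  · have hfw : f w = 0 := W.apply_eq_zero_of_forall_lt f.toLinearMap hfv hw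
    have hsum := LinearMap.pi_apply_eq_sum_univ f.toLinearMap w
    simp only [ContinuousLinearMap.coe_coe, hfw, smul_eq_mul] at hsum
    simp only [mul_neg, Finset.sum_neg_distrib, neg_eq_zero]
    rw [hsum]
    refine Finset.sum_congr rfl fun y _ => ?_
    congr 2
    ext z
    simp [Pi.single_apply, eq_comm]

/-- **Finite-state core of the Fundamental Theorem of Finance (Stiemke alternative).**
If for every coefficient vector `v` the linear combination `∑ k, v k • ξ k` is
either zero or has both a strictly positive and a strictly negative component,
then there is a strictly positive vector `g` orthogonal to every `ξ k`. -/
theorem stiemke_alternative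
    {D : Type*} [Fintype D] [Nonempty D]
    (n : ℕ) (ξ : Fin n → D → ℝ)
    (hNA : ∀ v : Fin n → ℝ,
      (∑ k : Fin n, v k • ξ k) = 0 ∨
        ∃ yp ym : D, 0 < (∑ k : Fin n, v k • ξ k) yp ∧
          (∑ k : Fin n, v k • ξ k) ym < 0) :
    ∃ g : D → ℝ, (∀ y : D, 0 < g y) ∧ ∀ k : Fin n, ∑ y : D, ξ k y * g y = 0 := by
  have hdisj : Disjoint (stdSimplex ℝ D) (Submodule.span ℝ (Set.range ξ) : Set (D → ℝ)) := by
    refine Set.disjoint_left.2 fun w hw hwξ => ?_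
    obtain ⟨v, rfl⟩ := (Submodule.mem_span_range_iff_exists_fun ℝ).1 hwξ
    rcases hNA v with h0 | ⟨_, y, _, hy⟩
    · rw [h0] at hw
      simpa using hw.2
    · exact (hw.1 y).not_gt hy
  obtain ⟨g, hg, hgξ⟩ := Submodule.exists_pos_orthogonal_of_disjoint_stdSimplex _ hdisj
  exact ⟨g, hg, fun k => hgξ _ (Submodule.subset_span (Set.mem_range_self k))⟩
end

section
/- (Bernstein function of the Gamma subordinator.) For every ν > 0 and every λ ≥ 0, the integral ∫_0^∞ (1 − Real.exp(−λ * t)) * t^{−1} * Real.exp(−t/ν) dt converges and equals Real.log(1 + ν * λ). -/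
open MeasureTheory

lemma integrableOn_one_sub_exp_mul_inv_mul_exp {ν lam : ℝ} (hν : 0 < ν) (hlam : 0 ≤ lam) :
    IntegrableOn
      (fun t : ℝ => (1 - Real.exp (-(lam * t))) * t⁻¹ * Real.exp (-(t / ν))) (Set.Ioi 0) := by
  have hdom : IntegrableOn (fun t : ℝ => lam * Real.exp (-ν⁻¹ * t)) (Set.Ioi 0) :=
    (integrableOn_exp_mul_Ioi (neg_lt_zero.2 (inv_pos.2 hν)) 0).const_mul lam
  refine Integrable.mono' hdom (by fun_prop) ?_
  filter_upwards [ae_restrict_mem measurableSet_Ioi] with t ht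
  have ht : 0 < t := ht
  have hle : Real.exp (-(lam * t)) ≤ 1 := Real.exp_le_one_iff.2 (by nlinarith)
  have hbound : (1 - Real.exp (-(lam * t))) * t⁻¹ ≤ lam := by
    rw [← div_eq_mul_inv, div_le_iff₀ ht]
    linarith [Real.add_one_le_exp (-(lam * t))]
  have hnonneg : 0 ≤ (1 - Real.exp (-(lam * t))) * t⁻¹ :=
    mul_nonneg (sub_nonneg.2 hle) (inv_pos.2 ht).le
  rw [Real.norm_of_nonneg (mul_nonneg hnonneg (Real.exp_pos _).le),
    show -(t / ν) = -ν⁻¹ * t by ring]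
  gcongr

/-- **Bernstein function of the Gamma subordinator.**
For `ν > 0` and `λ ≥ 0`, the integral `∫_0^∞ (1 - exp (-λ t)) t⁻¹ exp (-t/ν) dt`
converges and equals `log (1 + ν λ)`. -/
theorem gamma_subordinator_bernstein
    (ν lam : ℝ) (hν : 0 < ν) (hlam : 0 ≤ lam) :
    IntegrableOn
        (fun t : ℝ => (1 - Real.exp (-(lam * t))) * t⁻¹ * Real.exp (-(t / ν)))
        (Set.Ioi 0) ∧
      ∫ t in Set.Ioi (0 : ℝ),
          (1 - Real.exp (-(lam * t))) * t⁻¹ * Real.exp (-(t / ν))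
        = Real.log (1 + ν * lam) := by
  have hint := integrableOn_one_sub_exp_mul_inv_mul_exp hν hlam
  refine ⟨hint, ?_⟩
  have hν' : 0 < ν⁻¹ := inv_pos.2 hν
  have hfrullani : (fun t : ℝ => (1 - Real.exp (-(lam * t))) * t⁻¹ * Real.exp (-(t / ν))) =
      fun t => t⁻¹ • (Real.exp (-(ν⁻¹ * t)) - Real.exp (-((lam + ν⁻¹) * t))) := by
    funext t
    rw [show -((lam + ν⁻¹) * t) = -(lam * t) + -(ν⁻¹ * t) by ring, Real.exp_add,
      show t / ν = ν⁻¹ * t by ring, smul_eq_mul]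
    ring
  have hcont : Continuous fun x : ℝ => Real.exp (-x) := by fun_prop
  rw [hfrullani] at hint ⊢
  rw [Frullani.integral_Ioi_eq (f := fun x : ℝ => Real.exp (-x)) (L := 1) (R := 0)
    (hcont.locallyIntegrable.locallyIntegrableOn _) hν' (by positivity)
    ((hcont.tendsto' 0 1 (by simp)).mono_left nhdsWithin_le_nhds)
    Real.tendsto_exp_neg_atTop_nhds_zero hint, sub_zero, smul_eq_mul, mul_one]
  congr 1
  field_simp
  ring
end

section
/- (Bernstein function of the stable subordinator.) For every α ∈ (0, 1) and every λ ≥ 0, the integral ∫_0^∞ (1 − Real.exp(−λ * t)) * t^{−1−α} dt converges and (α / Real.Gamma(1 − α)) * ∫_0^∞ (1 − Real.exp(−λ * t)) * t^{−1−α} dt = λ^α. -/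
open MeasureTheory

theorem one_sub_exp_neg_mul_mem_Icc {lam t : ℝ} (hlam : 0 ≤ lam) (ht : 0 ≤ t) :
    1 - Real.exp (-(lam * t)) ∈ Set.Icc 0 (min (lam * t) 1) := by
  have h := Real.add_one_le_exp (-(lam * t))
  have h₁ : Real.exp (-(lam * t)) ≤ 1 := Real.exp_le_one_iff.2 (by nlinarith)
  have h₂ := Real.exp_pos (-(lam * t))
  exact ⟨by linarith, le_min (by linarith) (by linarith)⟩

theorem integrableOn_one_sub_exp_neg_mul_mul_rpow {α lam : ℝ} (hα : α ∈ Set.Ioo (0 : ℝ) 1)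
    (hlam : 0 ≤ lam) :
    IntegrableOn (fun t : ℝ => (1 - Real.exp (-(lam * t))) * t ^ (-1 - α)) (Set.Ioi 0) := by
  rw [← Set.Ioc_union_Ioi_eq_Ioi zero_le_one]
  have hm : Measurable (fun t : ℝ => (1 - Real.exp (-(lam * t))) * t ^ (-1 - α)) := by fun_prop
  refine IntegrableOn.union ?_ ?_
  · have hdom : IntegrableOn (fun t : ℝ => lam * t ^ (-α)) (Set.Ioc 0 1) :=
      ((intervalIntegrable_iff_integrableOn_Ioc_of_le zero_le_one).1
        (intervalIntegral.intervalIntegrable_rpow' (by linarith [hα.2]))).const_mul lam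
    refine Integrable.mono' hdom hm.aestronglyMeasurable
      ((ae_restrict_iff' measurableSet_Ioc).2 (.of_forall fun t ht => ?_))
    obtain ⟨h₀, h₁⟩ := one_sub_exp_neg_mul_mem_Icc hlam ht.1.le
    rw [Real.norm_of_nonneg (mul_nonneg h₀ (Real.rpow_nonneg ht.1.le _))]
    calc (1 - Real.exp (-(lam * t))) * t ^ (-1 - α)
        ≤ lam * t * t ^ (-1 - α) := by
          gcongr
          · exact Real.rpow_nonneg ht.1.le _
          · exact h₁.trans (min_le_left _ _)
      _ = lam * t ^ (-α) := by
          rw [mul_assoc, ← Real.rpow_one_add' ht.1.le (by linarith [hα.1])]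
          ring_nf
  · refine Integrable.mono' (integrableOn_Ioi_rpow_of_lt (by linarith [hα.1] : -1 - α < -1)
      zero_lt_one) hm.aestronglyMeasurable
      ((ae_restrict_iff' measurableSet_Ioi).2 (.of_forall fun t ht => ?_))
    have ht₀ : (0 : ℝ) ≤ t := zero_le_one.trans (le_of_lt ht)
    obtain ⟨h₀, h₁⟩ := one_sub_exp_neg_mul_mem_Icc hlam ht₀
    rw [Real.norm_of_nonneg (mul_nonneg h₀ (Real.rpow_nonneg ht₀ _))]
    exact mul_le_of_le_one_left (Real.rpow_nonneg ht₀ _) (h₁.trans (min_le_right _ _))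

open Filter Topology in
theorem mul_integral_one_sub_exp_neg_mul_mul_rpow {α lam : ℝ} (hα : α ∈ Set.Ioo (0 : ℝ) 1)
    (hlam : 0 < lam) :
    α * ∫ t in Set.Ioi (0 : ℝ), (1 - Real.exp (-(lam * t))) * t ^ (-1 - α) =
      lam ^ α * Real.Gamma (1 - α) := by
  have hα₁ : 0 < 1 - α := by linarith [hα.2]
  have hgamma := Real.integral_rpow_mul_exp_neg_mul_Ioi hα₁ hlam
  have hint : IntegrableOn (fun t : ℝ => t ^ (1 - α - 1) * Real.exp (-(lam * t))) (Set.Ioi 0) := by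
    refine Integrable.of_integral_ne_zero ?_
    rw [hgamma]
    exact (mul_pos (by positivity) (Real.Gamma_pos_of_pos hα₁)).ne'
  have hbound : ∀ t ∈ Set.Ioi (0 : ℝ), 0 ≤ (1 - Real.exp (-(lam * t))) * t ^ (-α) ∧
      (1 - Real.exp (-(lam * t))) * t ^ (-α) ≤ lam * t ^ (1 - α) ∧
      (1 - Real.exp (-(lam * t))) * t ^ (-α) ≤ t ^ (-α) := by
    intro t ht
    have ht₀ : (0 : ℝ) < t := ht
    obtain ⟨h₀, h₁⟩ := one_sub_exp_neg_mul_mem_Icc hlam.le ht₀.le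
    have hp : 0 ≤ t ^ (-α) := Real.rpow_nonneg ht₀.le _
    refine ⟨mul_nonneg h₀ hp, ?_, mul_le_of_le_one_left hp (h₁.trans (min_le_right _ _))⟩
    rw [sub_eq_add_neg 1 α, Real.rpow_one_add' ht₀.le (by linarith), ← mul_assoc]
    exact mul_le_mul_of_nonneg_right (h₁.trans (min_le_left _ _)) hp
  have hzero : Tendsto (fun t : ℝ => (1 - Real.exp (-(lam * t))) * t ^ (-α)) (𝓝[>] 0) (𝓝 0) := by
    have hlim : Tendsto (fun t : ℝ => lam * t ^ (1 - α)) (𝓝[>] 0) (𝓝 0) := by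
      have := ((Real.continuousAt_rpow_const 0 (1 - α) (.inr hα₁.le)).tendsto.const_mul lam)
      rw [Real.zero_rpow hα₁.ne', mul_zero] at this
      exact this.mono_left nhdsWithin_le_nhds
    refine tendsto_of_tendsto_of_tendsto_of_le_of_le' tendsto_const_nhds hlim ?_ ?_
    · filter_upwards [self_mem_nhdsWithin] with t ht using (hbound t ht).1
    · filter_upwards [self_mem_nhdsWithin] with t ht using (hbound t ht).2.1
  have htop : Tendsto (fun t : ℝ => (1 - Real.exp (-(lam * t))) * t ^ (-α)) atTop (𝓝 0) := by
    refine tendsto_of_tendsto_of_tendsto_of_le_of_le' tendsto_const_nhds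
      (tendsto_rpow_neg_atTop hα.1) ?_ ?_
    · filter_upwards [Ioi_mem_atTop 0] with t ht using (hbound t ht).1
    · filter_upwards [Ioi_mem_atTop 0] with t ht using (hbound t ht).2.2
  have hparts := integral_Ioi_mul_deriv_eq_deriv_mul
    (u := fun t : ℝ => 1 - Real.exp (-(lam * t))) (v := fun t : ℝ => t ^ (-α))
    (u' := fun t : ℝ => lam * Real.exp (-(lam * t))) (v' := fun t : ℝ => -α * t ^ (-α - 1))
    (a := 0) (a' := 0) (b' := 0)
    (fun t _ => ((((hasDerivAt_id t).const_mul lam).neg.exp).const_sub 1).congr_deriv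
      (by simp [mul_comm]))
    (fun t ht => Real.hasDerivAt_rpow_const (.inl (ne_of_gt ht)))
    (((integrableOn_one_sub_exp_neg_mul_mul_rpow hα hlam.le).const_mul (-α)).congr
      (.of_forall fun t => by
        simp only [Pi.mul_apply, show -α - 1 = -1 - α by ring]; ring))
    ((hint.const_mul lam).congr
      (.of_forall fun t => by
        simp only [Pi.mul_apply, show 1 - α - 1 = -α by ring]; ring))
    hzero htop
  have hleft : ∫ t in Set.Ioi (0 : ℝ), (1 - Real.exp (-(lam * t))) * (-α * t ^ (-α - 1)) =
      -α * ∫ t in Set.Ioi (0 : ℝ), (1 - Real.exp (-(lam * t))) * t ^ (-1 - α) := by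
    rw [← integral_const_mul]
    congr 1 with t
    rw [show -α - 1 = -1 - α by ring]; ring
  have hright : ∫ t in Set.Ioi (0 : ℝ), lam * Real.exp (-(lam * t)) * t ^ (-α) =
      lam * ∫ t in Set.Ioi (0 : ℝ), t ^ (1 - α - 1) * Real.exp (-(lam * t)) := by
    rw [← integral_const_mul]
    congr 1 with t
    rw [show 1 - α - 1 = -α by ring]; ring
  have hpow : lam * (1 / lam) ^ (1 - α) = lam ^ α := by
    rw [one_div, Real.inv_rpow hlam.le, ← Real.rpow_neg hlam.le,
      ← Real.rpow_one_add' hlam.le (by linarith [hα.1])]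
    ring_nf
  rw [hleft, hright, hgamma, ← mul_assoc, hpow] at hparts
  linarith

/-- **Bernstein function of the stable subordinator.**
For `α ∈ (0, 1)` and `λ ≥ 0`, the integral `∫_0^∞ (1 - exp (-λ t)) t^{-1-α} dt`
converges and `(α / Γ(1 - α)) * ∫_0^∞ (1 - exp (-λ t)) t^{-1-α} dt = λ^α`. -/
theorem stable_subordinator_bernstein
    (α lam : ℝ) (hα : α ∈ Set.Ioo (0 : ℝ) 1) (hlam : 0 ≤ lam) :
    IntegrableOn
        (fun t : ℝ => (1 - Real.exp (-(lam * t))) * t ^ (-1 - α))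
        (Set.Ioi 0) ∧
      (α / Real.Gamma (1 - α)) *
          ∫ t in Set.Ioi (0 : ℝ), (1 - Real.exp (-(lam * t))) * t ^ (-1 - α)
        = lam ^ α := by
  refine ⟨integrableOn_one_sub_exp_neg_mul_mul_rpow hα hlam, ?_⟩
  rcases hlam.eq_or_lt with rfl | hpos
  · simp [Real.zero_rpow hα.1.ne']
  · rw [div_mul_eq_mul_div, mul_integral_one_sub_exp_neg_mul_mul_rpow hα hpos,
      mul_div_cancel_right₀ _ (Real.Gamma_pos_of_pos (by linarith [hα.2])).ne']
end
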